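/- Let K be a field, S = K[x_1, …, x_n], and let I = I_{n,d} be the squarefree Veronese ideal of degree d, i.e., the ideal generated by all squarefree monomials of degree d in S. Then for every integer k ≥ 1, the minimal number of generators of I^k is μ(I^k) = Σ_{j=0}^{⌊kd/(k+1)⌋} (−1)^j · C(n, j) · C(kd + n − 1 − j(k+1), n − 1). -/

import Mathlib

/-- Binomial coefficient with an integer top argument, taken to be `0` when the
top argument is negative. -/
def zchoose (m : ℤ) (r : ℕ) : ℕ := if 0 ≤ m then m.toNat.choose r else 0

/-- The minimal number of generators of an ideal. -/
noncomputable def mu {R : Type*} [CommRing R] (I : Ideal R) : ℕ :=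
  sInf {m | ∃ s : Finset R, s.card = m ∧ Ideal.span (s : Set R) = I}

/-- The squarefree Veronese ideal `I_{n,d}` of degree `d`, generated by all
squarefree monomials of degree `d`, i.e. monomials `x_1^{b_1} ⋯ x_n^{b_n}` with
`∑ b_i = d` and `b_i ≤ 1` for all `i`. -/
noncomputable def squarefreeVeronese (K : Type*) [Field K] (n d : ℕ) :
    Ideal (MvPolynomial (Fin n) K) :=
  Ideal.span {m | ∃ b : Fin n → ℕ, (∑ i, b i) = d ∧ (∀ i, b i ≤ 1) ∧
    m = ∏ i, MvPolynomial.X i ^ b i}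

/-- Exponent vectors of the generators of the `k`-th power. -/
noncomputable def expSet (n k M : ℕ) : Finset (Fin n →₀ ℕ) :=
  (Finset.finsuppAntidiag Finset.univ M).filter (fun b => ∀ i, b i ≤ k)

lemma mem_expSet {n k M : ℕ} {b : Fin n →₀ ℕ} :
    b ∈ expSet n k M ↔ (∑ i, b i) = M ∧ ∀ i, b i ≤ k := by
  simp [expSet, Finset.mem_finsuppAntidiag]

lemma card_expSet (n k M : ℕ) (hn : 1 ≤ n) :
    ((expSet n k M).card : ℤ) =
      ∑ j ∈ Finset.range (M / (k + 1) + 1), (-1 : ℤ) ^ j * (n.choose j) *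
        zchoose ((M : ℤ) + n - 1 - j * ((k : ℤ) + 1)) (n - 1) := by
  have h1 : ((expSet n k M).card : ℤ) = PowerSeries.coeff M
      ((∑ i ∈ Finset.range (k + 1), (PowerSeries.X : PowerSeries ℤ) ^ i) ^ n) := by
    have : (∑ i ∈ Finset.range (k + 1), (PowerSeries.X : PowerSeries ℤ) ^ i) ^ n =
        ∏ j : Fin n, ∑ i ∈ Finset.range (k + 1), (PowerSeries.X : PowerSeries ℤ) ^ i := by simp
    rw [this, PowerSeries.coeff_prod]
    have h : ∀ m, PowerSeries.coeff m
        (∑ i ∈ Finset.range (k + 1), (PowerSeries.X : PowerSeries ℤ) ^ i)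
        = if m ≤ k then 1 else 0 := by
      intro m
      simp [map_sum, PowerSeries.coeff_X_pow, Nat.lt_succ_iff]
    simp only [h, Finset.prod_ite_zero, Finset.prod_const_one]
    simp [expSet, Finset.sum_boole]
  have h2 : (∑ i ∈ Finset.range (k + 1), (PowerSeries.X : PowerSeries ℤ) ^ i) ^ n =
      (1 - PowerSeries.X ^ (k + 1)) ^ n *
        PowerSeries.mk (fun m => ((n - 1 + m).choose (n - 1) : ℤ)) := by
    obtain ⟨r, rfl⟩ : ∃ r, n = r + 1 := ⟨n - 1, by omega⟩
    have h3 := PowerSeries.mk_add_choose_mul_one_sub_pow_eq_one (S := ℤ) (d := r)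
    rw [← geom_sum_mul_neg, mul_pow, mul_assoc, Nat.add_sub_cancel, mul_comm ((1 - PowerSeries.X) ^ _),
      h3, mul_one]
  rw [h1, h2, sub_eq_neg_add, add_pow, Finset.sum_mul, map_sum]
  have h4 : ∀ j, PowerSeries.coeff M ((-(PowerSeries.X : PowerSeries ℤ) ^ (k + 1)) ^ j * 1 ^ (n - j) *
      (n.choose j : PowerSeries ℤ) * PowerSeries.mk (fun m => ((n - 1 + m).choose (n - 1) : ℤ)))
      = if (k + 1) * j ≤ M then (-1 : ℤ) ^ j * (n.choose j) *
        zchoose ((M : ℤ) + n - 1 - j * ((k : ℤ) + 1)) (n - 1) else 0 := by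
    intro j
    have : (-(PowerSeries.X : PowerSeries ℤ) ^ (k + 1)) ^ j * 1 ^ (n - j) *
      (n.choose j : PowerSeries ℤ) * PowerSeries.mk (fun m => ((n - 1 + m).choose (n - 1) : ℤ))
      = PowerSeries.C ((-1 : ℤ) ^ j * (n.choose j)) * (PowerSeries.X ^ ((k + 1) * j) *
        PowerSeries.mk (fun m => ((n - 1 + m).choose (n - 1) : ℤ))) := by
      rw [neg_pow, pow_mul]
      simp
      ring
    rw [this, PowerSeries.coeff_C_mul, PowerSeries.coeff_X_pow_mul']
    split_ifs with hj
    · have e : (M : ℤ) + n - 1 - j * ((k : ℤ) + 1) = ((n - 1 + (M - (k + 1) * j) : ℕ) : ℤ) := by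
        push_cast [hj, hn]; ring
      rw [e, zchoose, if_pos (by positivity), Int.toNat_natCast, PowerSeries.coeff_mk]
    · simp
  simp only [h4]
  rw [← Finset.sum_filter]
  apply Finset.sum_subset_zero_on_sdiff
  · intro j
    simp only [Finset.mem_filter, Finset.mem_range]
    rintro ⟨-, h⟩
    rw [Nat.lt_succ_iff, Nat.le_div_iff_mul_le (by omega), mul_comm]; exact h
  · intro j
    simp only [Finset.mem_sdiff, Finset.mem_filter, Finset.mem_range]
    rintro ⟨h, h'⟩
    rw [Nat.lt_succ_iff, Nat.le_div_iff_mul_le (by omega), mul_comm] at h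
    rw [Nat.choose_eq_zero_of_lt (by by_contra hh; exact h' ⟨by omega, h⟩)]
    simp
  · intros; rfl

/-- The minimal number of generators of an equigenerated monomial ideal. -/
lemma mu_span_monomial (K : Type*) [Field K] {n D : ℕ} (B : Finset (Fin n →₀ ℕ))
    (hB : ∀ b ∈ B, ∑ i, b i = D) :
    mu (Ideal.span ((fun b => MvPolynomial.monomial b (1 : K)) '' (B : Set (Fin n →₀ ℕ)))) =
      B.card := by
  classical
  set J := Ideal.span ((fun b => MvPolynomial.monomial b (1 : K)) '' (B : Set (Fin n →₀ ℕ))) with hJ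
  have hlow : ∀ f ∈ J, ∀ m : Fin n →₀ ℕ, ∑ i, m i < D → MvPolynomial.coeff m f = 0 := by
    intro f hf m hm
    by_contra hne
    rw [hJ, MvPolynomial.mem_ideal_span_monomial_image] at hf
    obtain ⟨b, hb, hle⟩ := hf m (MvPolynomial.mem_support_iff.2 hne)
    have := hB b hb
    have := Finset.sum_le_sum (fun i (_ : i ∈ Finset.univ) => hle i)
    omega
  let φ : MvPolynomial (Fin n) K →ₗ[K] (B → K) :=
    LinearMap.pi (fun b => MvPolynomial.lcoeff K b.1)
  have hφ : ∀ f b, φ f b = MvPolynomial.coeff b.1 f := fun f b => rfl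
  have hmul : ∀ a, ∀ f ∈ J, φ (a * f) = MvPolynomial.coeff 0 a • φ f := by
    intro a f hf
    ext b
    rw [hφ, Pi.smul_apply, hφ, MvPolynomial.coeff_mul, smul_eq_mul]
    rw [Finset.sum_eq_single (0, b.1)]
    · rintro ⟨x, y⟩ hxy hne
      rw [Finset.HasAntidiagonal.mem_antidiagonal] at hxy
      have hx : x ≠ 0 := by
        rintro rfl
        apply hne
        simpa using hxy
      have h1 := hB b.1 b.2
      rw [← hxy] at h1
      simp only [Finsupp.add_apply, Finset.sum_add_distrib] at h1
      have h2 : 0 < ∑ i, x i := by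
        rw [Nat.pos_iff_ne_zero]
        intro h0
        apply hx
        ext i
        simpa using (Finset.sum_eq_zero_iff.1 h0) i (Finset.mem_univ i)
      rw [hlow f hf y (by omega), mul_zero]
    · intro h; simp at h
  apply le_antisymm
  · apply Nat.sInf_le
    refine ⟨B.image (fun b => MvPolynomial.monomial b (1 : K)), ?_, ?_⟩
    · apply Finset.card_image_of_injective
      exact MvPolynomial.monomial_left_injective one_ne_zero
    · rw [Finset.coe_image]
  · apply le_csInf
    · exact ⟨_, B.image (fun b => MvPolynomial.monomial b (1 : K)), rfl, by rw [Finset.coe_image]⟩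
    · rintro m ⟨s, rfl, hs⟩
      have hspan : ∀ f ∈ J, φ f ∈ Submodule.span K ((s.image φ : Finset (B → K)) : Set (B → K)) := by
        intro f hf
        rw [← hs] at hf
        induction hf using Submodule.span_induction with
        | mem x hx => exact Submodule.subset_span (by simpa using ⟨x, hx, rfl⟩)
        | zero => simp
        | add x y _ _ h1 h2 => rw [map_add]; exact add_mem h1 h2
        | smul a x hx h =>
          rw [smul_eq_mul, hmul a x (by rw [← hs]; exact hx)]
          exact Submodule.smul_mem _ _ h
      have htop : Submodule.span K ((s.image φ : Finset (B → K)) : Set (B → K)) = ⊤ := by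
        rw [eq_top_iff, ← (Pi.basisFun K B).span_eq, Submodule.span_le]
        rintro _ ⟨b, rfl⟩
        have := hspan (MvPolynomial.monomial b.1 1) (Ideal.subset_span ⟨b.1, b.2, rfl⟩)
        suffices he : (Pi.basisFun K B) b = φ (MvPolynomial.monomial b.1 1) by
          rw [he]; exact this
        ext c
        rw [hφ, MvPolynomial.coeff_monomial]
        rw [Pi.basisFun_apply, Pi.single_apply]
        by_cases hc : c = b
        · rw [if_pos hc, if_pos (by rw [hc])]
        · rw [if_neg hc, if_neg (fun h => hc (Subtype.ext h.symm))]
      have h := finrank_span_finset_le_card (R := K) (s.image φ)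
      rw [Set.finrank, htop, finrank_top] at h
      simp at h
      exact h.trans Finset.card_image_le

lemma exists_split {n k d : ℕ} (b : Fin n →₀ ℕ) (hb : b ∈ expSet n (k + 1) ((k + 1) * d)) :
    ∃ x ∈ expSet n k (k * d), ∃ y ∈ expSet n 1 d, x + y = b := by
  classical
  rw [mem_expSet] at hb
  obtain ⟨hs, hle⟩ := hb
  have h1 : (Finset.univ.filter (fun i => b i = k + 1)).card ≤ d := by
    have : (k + 1) * (Finset.univ.filter (fun i => b i = k + 1)).card ≤ (k + 1) * d := by
      rw [← hs, Finset.card_filter, Finset.mul_sum]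
      apply Finset.sum_le_sum
      intro i _
      split_ifs with h <;> simp [h]
    exact Nat.le_of_mul_le_mul_left this (by omega)
  have h2 : d ≤ (Finset.univ.filter (fun i => b i ≠ 0)).card := by
    have : (k + 1) * d ≤ (k + 1) * (Finset.univ.filter (fun i => b i ≠ 0)).card := by
      rw [← hs, Finset.card_filter, Finset.mul_sum]
      apply Finset.sum_le_sum
      intro i _
      have := hle i
      split_ifs with h
      · simpa using this
      · simpa using h
    exact Nat.le_of_mul_le_mul_left this (by omega)
  obtain ⟨T, hT1, hT2, hT⟩ := Finset.exists_subsuperset_card_eq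
    (s := Finset.univ.filter (fun i => b i = k + 1))
    (t := Finset.univ.filter (fun i => b i ≠ 0)) (n := d)
    (by intro i; simp; intro h; omega) h1 h2
  have hy : ∀ i, i ∈ T → b i ≠ 0 := fun i hi => by simpa using hT2 hi
  have hx : ∀ i, i ∉ T → b i ≠ k + 1 := fun i hi h => hi (hT1 (by simpa using h))
  let y : Fin n →₀ ℕ := Finsupp.equivFunOnFinite.symm (fun i => if i ∈ T then 1 else 0)
  have hyi : ∀ i, y i = if i ∈ T then 1 else 0 := fun i => rfl
  have hysum : ∑ i, y i = d := by simp [hyi, hT]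
  have hyb : y ≤ b := by
    intro i
    rw [hyi]
    split_ifs with h
    · have := hy i h; omega
    · omega
  have hadd : b - y + y = b := tsub_add_cancel_of_le hyb
  refine ⟨b - y, mem_expSet.2 ⟨?_, ?_⟩, y, mem_expSet.2 ⟨hysum, ?_⟩, hadd⟩
  · have : ∑ i, ((b - y) i + y i) = (k + 1) * d := by
      rw [← hs]
      exact Finset.sum_congr rfl (fun i _ => by rw [← Finsupp.add_apply, hadd])
    rw [Finset.sum_add_distrib, hysum, add_mul, one_mul] at this
    omega
  · intro i
    rw [Finsupp.tsub_apply, hyi]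
    have := hle i
    split_ifs with h
    · omega
    · have := hx i h; omega
  · intro i
    rw [hyi]; split_ifs <;> simp

lemma veronese_eq (K : Type*) [Field K] (n d : ℕ) :
    squarefreeVeronese K n d = Ideal.span ((fun b => MvPolynomial.monomial b (1 : K)) ''
      (expSet n 1 d : Set (Fin n →₀ ℕ))) := by
  unfold squarefreeVeronese
  congr 1
  ext m
  simp only [Set.mem_setOf_eq, Set.mem_image, Finset.mem_coe, mem_expSet]
  have key : ∀ b : Fin n →₀ ℕ, MvPolynomial.monomial b (1 : K) = ∏ i, MvPolynomial.X i ^ b i := by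
    intro b
    rw [MvPolynomial.monomial_eq, Finsupp.prod_fintype _ _ (by simp)]
    simp
  constructor
  · rintro ⟨b, h1, h2, rfl⟩
    exact ⟨Finsupp.equivFunOnFinite.symm b, ⟨h1, h2⟩, key _⟩
  · rintro ⟨b, ⟨h1, h2⟩, rfl⟩
    exact ⟨b, h1, h2, key b⟩

lemma veronese_pow (K : Type*) [Field K] (n d k : ℕ) :
    squarefreeVeronese K n d ^ k = Ideal.span ((fun b => MvPolynomial.monomial b (1 : K)) ''
      (expSet n k (k * d) : Set (Fin n →₀ ℕ))) := by
  induction k with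
  | zero =>
    have : (expSet n 0 (0 * d) : Set (Fin n →₀ ℕ)) = {0} := by
      ext b
      simp only [Finset.mem_coe, mem_expSet, Set.mem_singleton_iff, zero_mul]
      constructor
      · rintro ⟨-, h⟩
        ext i
        simpa using h i
      · rintro rfl
        simp
    rw [this]
    simp
  | succ k ih =>
    rw [pow_succ, ih, veronese_eq, Ideal.span_mul_span']
    congr 1
    ext m
    simp only [Set.mem_mul, Set.mem_image, Finset.mem_coe]
    constructor
    · rintro ⟨_, ⟨x, hx, rfl⟩, _, ⟨y, hy, rfl⟩, rfl⟩
      refine ⟨x + y, ?_, by simp [MvPolynomial.monomial_mul]⟩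
      rw [mem_expSet] at *
      refine ⟨?_, fun i => add_le_add (hx.2 i) (hy.2 i)⟩
      simp only [Finsupp.add_apply, Finset.sum_add_distrib, hx.1, hy.1]
      ring
    · rintro ⟨b, hb, rfl⟩
      obtain ⟨x, hx, y, hy, rfl⟩ := exists_split b hb
      exact ⟨_, ⟨x, hx, rfl⟩, _, ⟨y, hy, rfl⟩, by simp [MvPolynomial.monomial_mul]⟩

/-- The minimal number of generators of powers of the squarefree Veronese ideal. -/
theorem stmt8 (K : Type*) [Field K] (n d : ℕ) (hn : 1 ≤ n) (hd : 1 ≤ d)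
    (k : ℕ) (hk : 1 ≤ k) :
    (mu ((squarefreeVeronese K n d) ^ k) : ℤ) =
      ∑ j ∈ Finset.range (k * d / (k + 1) + 1), (-1 : ℤ) ^ j * (n.choose j) *
        zchoose ((k : ℤ) * d + n - 1 - j * ((k : ℤ) + 1)) (n - 1) := by
  rw [veronese_pow, mu_span_monomial K (D := k * d) _ (fun b hb => (mem_expSet.1 hb).1),
    card_expSet n k (k * d) hn]
  push_cast
  rfl
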